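/- arXiv:2206.11236 — 3 statements merged into one kernel-verified Lean document; each statement's English description precedes it below -/
import Mathlib

section
/- For n ≥ 2 and 1 ≤ j ≤ n-1, the sum over derangements σ of [n] with σ(n+1-j) = 1 of (-1)^{cyc(σ)} · ∏_{i ∈ RLMi(σ)} x_i · ∏_{i ∈ EXCi(σ)} y_i equals -y₁⋯y_{n-j} · x_{n+1-j}⋯x_n. -/
open Finset

/-- Number of cycles of a permutation (counting fixed points as 1-cycles). -/
def cyc {n : ℕ} (σ : Equiv.Perm (Fin n)) : ℕ :=
  σ.cycleType.card + (Finset.univ.filter fun i => σ i = i).card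

/-- Set of excedance indices of a permutation. -/
def excIdx {n : ℕ} (σ : Equiv.Perm (Fin n)) : Finset (Fin n) :=
  Finset.univ.filter fun i => i < σ i

/-- Set of right-to-left minimum indices. -/
def rlmIdx {n : ℕ} (σ : Equiv.Perm (Fin n)) : Finset (Fin n) :=
  Finset.univ.filter fun i => ∀ k, i < k → σ i < σ k

theorem cyc_sign {n : ℕ} (σ : Equiv.Perm (Fin n)) :
    ((-1 : ℤˣ)) ^ cyc σ = (-1) ^ n * Equiv.Perm.sign σ := by
  rw [Equiv.Perm.sign_of_cycleType, Equiv.Perm.sum_cycleType]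
  have h : (Finset.univ.filter fun i => σ i = i).card + σ.support.card = n := by
    have := Finset.card_filter_add_card_filter_not (s := (Finset.univ : Finset (Fin n))) (fun i => σ i = i)
    rw [Finset.card_univ, Fintype.card_fin] at this
    have e : σ.support = Finset.univ.filter (fun i => ¬ σ i = i) := by
      ext i; simp [Equiv.Perm.mem_support]
    rw [e]; exact this
  unfold cyc
  rw [← pow_add]
  have e : n + (σ.support.card + σ.cycleType.card) =
     σ.cycleType.card + (Finset.univ.filter fun i => σ i = i).card + (2 * σ.support.card) := by omega
  rw [e, pow_add _ _ (2 * σ.support.card), pow_mul]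
  simp

def wt {R : Type*} [CommRing R] {n : ℕ} (x y : Fin n → R) (σ : Equiv.Perm (Fin n)) : R :=
  (-1 : R) ^ cyc σ * (∏ i ∈ rlmIdx σ, x i) * (∏ i ∈ excIdx σ, y i)

theorem wt_cancel {R : Type*} [CommRing R] {n : ℕ} (x y : Fin n → R) (σ τ : Equiv.Perm (Fin n))
    (hs : Equiv.Perm.sign τ = - Equiv.Perm.sign σ)
    (hr : ∀ i, (∀ k, i < k → σ i < σ k) ↔ (∀ k, i < k → τ i < τ k))
    (he : ∀ i, i < σ i ↔ i < τ i) : wt x y σ + wt x y τ = 0 := by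
  have h1 : rlmIdx τ = rlmIdx σ := by
    unfold rlmIdx; ext i; simp only [mem_filter, mem_univ, true_and]; exact (hr i).symm
  have h2 : excIdx τ = excIdx σ := by
    unfold excIdx; ext i; simp only [mem_filter, mem_univ, true_and]; exact (he i).symm
  have h3 : (-1 : ℤˣ) ^ cyc τ = - (-1 : ℤˣ) ^ cyc σ := by
    rw [cyc_sign, cyc_sign, hs]; simp
  have h4 : (-1 : R) ^ cyc τ = - (-1 : R) ^ cyc σ := by
    have := congrArg (fun u : ℤˣ => (((u : ℤˣ) : ℤ) : R)) h3
    simpa using this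
  unfold wt
  rw [h1, h2, h4]; ring

theorem step_sum {R : Type*} [CommRing R] {n : ℕ} (x y : Fin n → R)
    (A B : Equiv.Perm (Fin n) → Prop) [DecidablePred A] [DecidablePred B]
    (hBA : ∀ σ, B σ → A σ)
    (g : Equiv.Perm (Fin n) → Equiv.Perm (Fin n))
    (hg : ∀ σ, A σ → ¬ B σ → A (g σ) ∧ ¬ B (g σ) ∧ g (g σ) = σ ∧ g σ ≠ σ ∧
      wt x y σ + wt x y (g σ) = 0) :
    ∑ σ ∈ univ.filter A, wt x y σ = ∑ σ ∈ univ.filter B, wt x y σ := by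
  rw [← Finset.sum_filter_add_sum_filter_not (univ.filter A) B]
  have h0 : ∑ σ ∈ (univ.filter A).filter (fun σ => ¬ B σ), wt x y σ = 0 := by
    apply Finset.sum_involution (fun σ _ => g σ)
    · intro σ hσ
      simp only [mem_filter, mem_univ, true_and] at hσ
      exact (hg σ hσ.1 hσ.2).2.2.2.2
    · intro σ hσ _
      simp only [mem_filter, mem_univ, true_and] at hσ
      exact (hg σ hσ.1 hσ.2).2.2.2.1
    · intro σ hσ
      simp only [mem_filter, mem_univ, true_and] at hσ ⊢
      exact ⟨(hg σ hσ.1 hσ.2).1, (hg σ hσ.1 hσ.2).2.1⟩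
    · intro σ hσ
      simp only [mem_filter, mem_univ, true_and] at hσ
      exact (hg σ hσ.1 hσ.2).2.2.1
  rw [h0, add_zero]
  apply Finset.sum_congr _ (fun _ _ => rfl)
  ext σ
  simp only [mem_filter, mem_univ, true_and]
  exact ⟨fun h => h.2, fun h => ⟨hBA σ h, h⟩⟩

/-- First phase: `σ P = 0`, `σ i = i + 1` for `i < k`. -/
def PA (n P k : ℕ) (σ : Equiv.Perm (Fin n)) : Prop :=
  (∀ i, σ i ≠ i) ∧ (∀ i : Fin n, i.val = P → (σ i).val = 0) ∧
    (∀ i : Fin n, i.val < k → (σ i).val = i.val + 1)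

/-- Second phase. -/
def PB (n P k : ℕ) (σ : Equiv.Perm (Fin n)) : Prop :=
  (∀ i, σ i ≠ i) ∧ (∀ i : Fin n, i.val = P → (σ i).val = 0) ∧
    (∀ i : Fin n, i.val + 1 < P → (σ i).val = i.val + 1) ∧
    (∀ i : Fin n, P < i.val → i.val ≤ k → (σ i).val + 1 = i.val)

theorem not_rlm {n P : ℕ} (hP : P < n) (σ : Equiv.Perm (Fin n))
    (h : ∀ i : Fin n, i.val = P → (σ i).val = 0) (i : Fin n) (hi : i.val < P) :
    ¬ (∀ k, i < k → σ i < σ k) := by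
  intro hh
  have := hh ⟨P, hP⟩ hi
  rw [Fin.lt_def, h ⟨P, hP⟩ rfl] at this
  omega

theorem PA_lb {n P k : ℕ} (hP : P < n) (hk : k + 1 < P) (σ : Equiv.Perm (Fin n))
    (h : PA n P k σ) (i : Fin n) (hi : k ≤ i.val) (hi2 : i.val < P) : k < (σ i).val := by
  obtain ⟨h1, h2, h3⟩ := h
  by_contra hc
  rcases Nat.eq_zero_or_pos (σ i).val with h0 | h0
  · have : σ i = σ ⟨P, hP⟩ := Fin.ext (by rw [h0, h2 _ rfl])
    have := congrArg Fin.val (σ.injective this)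
    simp at this; omega
  · have : σ i = σ ⟨(σ i).val - 1, by omega⟩ := Fin.ext (by
      have := h3 ⟨(σ i).val - 1, by omega⟩ (by simp; omega)
      simp at this; omega)
    have := congrArg Fin.val (σ.injective this)
    simp at this; omega

theorem stepA {R : Type*} [CommRing R] {n P k : ℕ} (x y : Fin n → R) (hP : P < n) (hk : k + 1 < P)
    [DecidablePred (PA n P k)] [DecidablePred (PA n P (k+1))] :
    ∑ σ ∈ univ.filter (PA n P k), wt x y σ = ∑ σ ∈ univ.filter (PA n P (k+1)), wt x y σ := by
  obtain ⟨a, ha⟩ : ∃ a : Fin n, a.val = k := ⟨⟨k, by omega⟩, rfl⟩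
  obtain ⟨b, hb⟩ : ∃ a : Fin n, a.val = k + 1 := ⟨⟨k+1, by omega⟩, rfl⟩
  have hab : a ≠ b := by intro h; rw [h] at ha; omega
  apply step_sum x y _ _ _ (fun σ => σ * Equiv.swap a b)
  · intro σ h h'
    have hσa : k + 2 ≤ (σ a).val := by
      have l := PA_lb hP hk σ h a (by omega) (by omega)
      by_contra hc
      apply h'
      refine ⟨h.1, h.2.1, fun i hi => ?_⟩
      rcases Nat.lt_succ_iff_lt_or_eq.mp hi with h4 | h4
      · exact h.2.2 i h4
      · have : i = a := Fin.ext (by omega)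
        subst this; omega
    have hσb : k + 2 ≤ (σ b).val := by
      have l := PA_lb hP hk σ h b (by omega) (by omega)
      have : (σ b).val ≠ b.val := fun h4 => h.1 b (Fin.ext h4)
      omega
    have ea : (σ * Equiv.swap a b) a = σ b := by simp
    have eb : (σ * Equiv.swap a b) b = σ a := by simp
    have ec : ∀ i, i ≠ a → i ≠ b → (σ * Equiv.swap a b) i = σ i := by
      intro i h1 h2; simp [Equiv.swap_apply_of_ne_of_ne h1 h2]
    have hz : ∀ i : Fin n, i.val = P → ((σ * Equiv.swap a b) i).val = 0 := by
      intro i hi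
      rw [ec i (by rintro rfl; omega) (by rintro rfl; omega)]
      exact h.2.1 i hi
    refine ⟨⟨?_, hz, ?_⟩, ?_, ?_, ?_, ?_⟩
    · intro i
      by_cases h1 : i = a
      · subst h1; rw [ea]; intro h5; rw [h5] at hσb; omega
      by_cases h2 : i = b
      · subst h2; rw [eb]; intro h5; rw [h5] at hσa; omega
      rw [ec i h1 h2]; exact h.1 i
    · intro i hi
      rw [ec i (by rintro rfl; omega) (by rintro rfl; omega)]
      exact h.2.2 i hi
    · intro h5
      have := h5.2.2 a (by omega)
      rw [ea] at this; omega
    · simp [mul_assoc]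
    · intro h5
      rw [h5] at ea
      exact hab (σ.injective ea)
    · apply wt_cancel
      · simp [Equiv.Perm.sign_swap hab]
      · intro i
        by_cases hi : i.val < P
        · exact iff_of_false (not_rlm hP _ h.2.1 i hi) (not_rlm hP _ hz i hi)
        · refine forall_congr' fun l => ?_
          refine imp_congr_right fun hl => ?_
          have hl' : i.val < l.val := hl
          rw [ec i (by rintro rfl; omega) (by rintro rfl; omega),
            ec l (by rintro rfl; omega) (by rintro rfl; omega)]
      · intro i
        by_cases h1 : i = a
        · subst h1; rw [ea, Fin.lt_def, Fin.lt_def]; omega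
        by_cases h2 : i = b
        · subst h2; rw [eb, Fin.lt_def, Fin.lt_def]; omega
        rw [ec i h1 h2]
  · intro σ h
    exact ⟨h.1, h.2.1, fun i hi => h.2.2 i (by omega)⟩

theorem PB_lb {n P k : ℕ} (hP : P < n) (hP1 : 1 ≤ P) (hPk : P ≤ k) (hk : k + 1 < n)
    (σ : Equiv.Perm (Fin n))
    (h : PB n P k σ) (i : Fin n) (hi : i.val + 1 = P ∨ k < i.val) : k ≤ (σ i).val := by
  obtain ⟨h1, h2, h3, h4⟩ := h
  by_contra hc
  rcases Nat.eq_zero_or_pos (σ i).val with h0 | h0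
  · have : σ i = σ ⟨P, hP⟩ := Fin.ext (by rw [h0, h2 _ rfl])
    have := congrArg Fin.val (σ.injective this)
    simp at this; omega
  by_cases h5 : (σ i).val < P
  · have : σ i = σ ⟨(σ i).val - 1, by omega⟩ := Fin.ext (by
      have := h3 ⟨(σ i).val - 1, by omega⟩ (by simp; omega)
      simp at this; omega)
    have := congrArg Fin.val (σ.injective this)
    simp at this; omega
  · have : σ i = σ ⟨(σ i).val + 1, by omega⟩ := Fin.ext (by
      have := h4 ⟨(σ i).val + 1, by omega⟩ (by simp; omega) (by simp; omega)
      simp at this; omega)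
    have := congrArg Fin.val (σ.injective this)
    simp at this; omega

theorem PB_ub {n P k : ℕ} (hP1 : 1 ≤ P) (hPk : P ≤ k)
    (σ : Equiv.Perm (Fin n))
    (h : PB n P k σ) (i : Fin n) (hi : i.val + 1 ≠ P) (hi2 : i.val ≤ k) : (σ i).val < k := by
  obtain ⟨h1, h2, h3, h4⟩ := h
  rcases lt_trichotomy i.val P with h5 | h5 | h5
  · have := h3 i (by omega); omega
  · have := h2 i h5; omega
  · have := h4 i h5 hi2; omega

theorem stepB {R : Type*} [CommRing R] {n P k : ℕ} (x y : Fin n → R) (hP : P < n) (hP1 : 1 ≤ P)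
    (hPk : P ≤ k) (hk : k + 1 < n)
    [DecidablePred (PB n P k)] [DecidablePred (PB n P (k+1))] :
    ∑ σ ∈ univ.filter (PB n P k), wt x y σ = ∑ σ ∈ univ.filter (PB n P (k+1)), wt x y σ := by
  obtain ⟨r, hr⟩ : ∃ a : Fin n, a.val + 1 = P := ⟨⟨P - 1, by omega⟩, by simp; omega⟩
  obtain ⟨a, ha⟩ : ∃ a : Fin n, a.val = k := ⟨⟨k, by omega⟩, rfl⟩
  obtain ⟨b, hb⟩ : ∃ a : Fin n, a.val = k + 1 := ⟨⟨k+1, by omega⟩, rfl⟩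
  have hab : a ≠ b := by intro h; rw [h] at ha; omega
  have hrb : r ≠ b := by intro h; rw [h] at hr; omega
  apply step_sum x y _ _ _ (fun σ => if k + 2 ≤ (σ r).val then σ * Equiv.swap r b
    else Equiv.swap a b * σ)
  · intro σ h h'
    have lb := PB_lb hP hP1 hPk hk σ h
    have ub := PB_ub hP1 hPk σ h
    have hσb : k + 2 ≤ (σ b).val := by
      have l := lb b (by omega)
      have l2 : (σ b).val ≠ b.val := fun h4 => h.1 b (Fin.ext h4)
      by_contra hc
      apply h'
      refine ⟨h.1, h.2.1, h.2.2.1, fun i hi hi2 => ?_⟩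
      rcases Nat.le_succ_iff.mp hi2 with h4 | h4
      · exact h.2.2.2 i hi h4
      · have : i = b := Fin.ext (by omega)
        subst this; omega
    by_cases hc : k + 2 ≤ (σ r).val
    · have ea : (σ * Equiv.swap r b) r = σ b := by simp
      have eb : (σ * Equiv.swap r b) b = σ r := by simp
      have ec : ∀ i, i ≠ r → i ≠ b → (σ * Equiv.swap r b) i = σ i := by
        intro i h1 h2; simp [Equiv.swap_apply_of_ne_of_ne h1 h2]
      have hz : ∀ i : Fin n, i.val = P → ((σ * Equiv.swap r b) i).val = 0 := by
        intro i hi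
        rw [ec i (by rintro rfl; omega) (by rintro rfl; omega)]
        exact h.2.1 i hi
      have hB : PB n P k (σ * Equiv.swap r b) := by
        refine ⟨?_, hz, ?_, ?_⟩
        · intro i
          by_cases h1 : i = r
          · subst h1; rw [ea]; intro h5; rw [h5] at hσb; omega
          by_cases h2 : i = b
          · subst h2; rw [eb]; intro h5; rw [h5] at hc; omega
          rw [ec i h1 h2]; exact h.1 i
        · intro i hi
          rw [ec i (by rintro rfl; omega) (by rintro rfl; omega)]
          exact h.2.2.1 i hi
        · intro i hi hi2
          rw [ec i (by rintro rfl; omega) (by rintro rfl; omega)]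
          exact h.2.2.2 i hi hi2
      have hc' : k + 2 ≤ ((σ * Equiv.swap r b) r).val := by rw [ea]; exact hσb
      simp only [if_pos hc, if_pos hc']
      refine ⟨hB, ?_, ?_, ?_, ?_⟩
      · intro h5
        have := h5.2.2.2 b (by omega) (by omega)
        rw [eb] at this; omega
      · simp [mul_assoc]
      · intro h5
        rw [h5] at ea
        exact hrb (σ.injective ea)
      · apply wt_cancel
        · simp [Equiv.Perm.sign_swap hrb]
        · -- the position of the value `k`
          obtain ⟨c, hcv⟩ := σ.surjective a
          have hcr : c ≠ r := by rintro rfl; rw [hcv] at hc; omega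
          have hcb : c ≠ b := by rintro rfl; rw [hcv] at hσb; omega
          have hck : k + 1 < c.val := by
            by_contra h6
            have h7 : c.val ≠ b.val := fun h => hcb (Fin.ext h)
            have h8 : c.val ≠ r.val := fun h => hcr (Fin.ext h)
            have := ub c (by omega) (by omega)
            rw [hcv] at this; omega
          intro i
          by_cases hi : i.val < P
          · exact iff_of_false (not_rlm hP _ h.2.1 i hi) (not_rlm hP _ hz i hi)
          have hir : i ≠ r := by rintro rfl; omega
          by_cases hib : i = b
          · subst hib
            refine iff_of_false (fun h6 => ?_) (fun h6 => ?_)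
            · have := h6 c (by rw [Fin.lt_def]; omega)
              rw [hcv, Fin.lt_def] at this; omega
            · have := h6 c (by rw [Fin.lt_def]; omega)
              rw [ec c hcr hcb, eb, hcv, Fin.lt_def] at this; omega
          refine forall_congr' fun l => ?_
          refine imp_congr_right fun hl => ?_
          have hl' : i.val < l.val := hl
          by_cases hlb : l = b
          · subst hlb
            rw [ec i hir hib, eb, Fin.lt_def, Fin.lt_def]
            have := ub i (by omega) (by omega)
            omega
          rw [ec i hir hib, ec l (by rintro rfl; omega) hlb]
        · intro i
          by_cases h1 : i = r
          · subst h1; rw [ea, Fin.lt_def, Fin.lt_def]; omega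
          by_cases h2 : i = b
          · subst h2; rw [eb, Fin.lt_def, Fin.lt_def]; omega
          rw [ec i h1 h2]
    · have hlr := lb r (by omega)
      -- description of the swap on values
      have sv : ∀ v : Fin n, (v.val = k → (Equiv.swap a b v).val = k + 1) ∧
          (v.val = k + 1 → (Equiv.swap a b v).val = k) ∧
          (v.val ≠ k → v.val ≠ k + 1 → (Equiv.swap a b v).val = v.val) := by
        intro v
        refine ⟨fun h1 => ?_, fun h1 => ?_, fun h1 h2 => ?_⟩
        · have : v = a := Fin.ext (by omega)
          subst this; simp [hb]
        · have : v = b := Fin.ext (by omega)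
          subst this; simp [ha]
        · rw [Equiv.swap_apply_of_ne_of_ne (by rintro rfl; omega) (by rintro rfl; omega)]
      have hinj : ∀ i l : Fin n, i ≠ l → (σ i).val ≠ (σ l).val :=
        fun i l h1 h2 => h1 (σ.injective (Fin.ext h2))
      have sσ : ∀ i, (Equiv.swap a b * σ) i = Equiv.swap a b (σ i) := fun i => rfl
      -- positions other than `r` carrying `k` or `k+1` are far right
      have far : ∀ i, i ≠ r → ((σ i).val = k ∨ (σ i).val = k + 1) → k + 1 < i.val := by
        intro i h1 h2
        have h1' : i.val ≠ r.val := fun h => h1 (Fin.ext h)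
        by_contra h3
        by_cases h4 : i.val ≤ k
        · have := ub i (by omega) h4; omega
        · have : i = b := Fin.ext (by omega)
          subst this; omega
      have hsm : ∀ i, (σ i).val < k → ((Equiv.swap a b * σ) i).val = (σ i).val := by
        intro i hi; rw [sσ]; exact (sv (σ i)).2.2 (by omega) (by omega)
      have hz : ∀ i : Fin n, i.val = P → ((Equiv.swap a b * σ) i).val = 0 := by
        intro i hi
        have := h.2.1 i hi
        rw [hsm i (by omega), this]
      have hexc : ∀ i, i < σ i ↔ i < (Equiv.swap a b * σ) i := by
        intro i
        rw [sσ, Fin.lt_def, Fin.lt_def]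
        have s := sv (σ i)
        by_cases h1 : i = r
        · subst h1; omega
        have f := far i h1
        omega
      have hder : ∀ i, (Equiv.swap a b * σ) i ≠ i := by
        intro i h5
        have h5 := congrArg Fin.val h5
        rw [sσ] at h5
        have s := sv (σ i)
        have l2 : (σ i).val ≠ i.val := fun h4 => h.1 i (Fin.ext h4)
        by_cases h1 : i = r
        · subst h1; omega
        have f := far i h1
        omega
      have hc' : ¬ k + 2 ≤ ((Equiv.swap a b * σ) r).val := by
        rw [sσ]; have := sv (σ r); omega
      simp only [if_neg hc, if_neg hc']
      refine ⟨⟨hder, hz, ?_, ?_⟩, ?_, ?_, ?_, ?_⟩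
      · intro i hi
        have := h.2.2.1 i hi
        rw [hsm i (by omega), this]
      · intro i hi hi2
        have := h.2.2.2 i hi hi2
        rw [hsm i (by omega), this]
      · intro h5
        have := h5.2.2.2 b (by omega) (by omega)
        rw [sσ] at this
        have s := sv (σ b)
        omega
      · rw [← mul_assoc, Equiv.swap_mul_self, one_mul]
      · intro h5
        have h6 := congrArg (fun τ : Equiv.Perm (Fin n) => (τ r).val) h5
        simp only [sσ] at h6
        have s := sv (σ r)
        omega
      · apply wt_cancel
        · simp [Equiv.Perm.sign_swap hab]
        · intro i
          by_cases hi : i.val < P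
          · exact iff_of_false (not_rlm hP _ h.2.1 i hi) (not_rlm hP _ hz i hi)
          refine forall_congr' fun l => ?_
          refine imp_congr_right fun hl => ?_
          have hl' : i.val < l.val := hl
          rw [sσ, sσ, Fin.lt_def, Fin.lt_def]
          have s1 := sv (σ i)
          have s2 := sv (σ l)
          have h1 := hinj i l (by rintro rfl; omega)
          have h2 := hinj i r (by rintro rfl; omega)
          have h3 := hinj l r (by rintro rfl; omega)
          omega
        · exact hexc
  · intro σ h
    exact ⟨h.1, h.2.1, h.2.2.1, fun i hi hi2 => h.2.2.2 i hi (by omega)⟩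

theorem final_unique {n P : ℕ} (hP : P < n) (hP1 : 1 ≤ P) (σ τ : Equiv.Perm (Fin n))
    (h : PB n P (n-1) σ) (h' : PB n P (n-1) τ) : σ = τ := by
  have key : ∀ i : Fin n, i.val + 1 ≠ P → σ i = τ i := by
    intro i hi
    apply Fin.ext
    rcases lt_trichotomy i.val P with h5 | h5 | h5
    · rw [h.2.2.1 i (by omega), h'.2.2.1 i (by omega)]
    · rw [h.2.1 i h5, h'.2.1 i h5]
    · have := h.2.2.2 i h5 (by omega)
      have := h'.2.2.2 i h5 (by omega)
      omega
  ext1 i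
  by_cases hi : i.val + 1 = P
  · obtain ⟨l, hl⟩ := τ.surjective (σ i)
    by_cases hli : l = i
    · rw [← hl, hli]
    · have : σ l = τ l := key l (fun h => hli (Fin.ext (by omega)))
      rw [hl] at this
      exact absurd (σ.injective this) hli
  · exact key i hi

theorem final_exists {n P : ℕ} (hP : P < n) (hP1 : 1 ≤ P) :
    ∃ σ : Equiv.Perm (Fin n), PB n P (n-1) σ ∧ ∀ i : Fin n, i.val + 1 = P → (σ i).val + 1 = n := by
  let f : Fin n → Fin n := fun i =>
    ⟨if i.val + 1 < P then i.val + 1 else if i.val + 1 = P then n - 1 else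
      if i.val = P then 0 else i.val - 1, by split_ifs <;> omega⟩
  have hv : ∀ i, (f i).val = if i.val + 1 < P then i.val + 1 else if i.val + 1 = P then n - 1 else
      if i.val = P then 0 else i.val - 1 := fun i => rfl
  have hf : Function.Injective f := by
    intro i l h
    have h := congrArg Fin.val h
    rw [hv, hv] at h
    apply Fin.ext
    split_ifs at h <;> omega
  refine ⟨Equiv.ofBijective f (Finite.injective_iff_bijective.mp hf), ⟨?_, ?_, ?_, ?_⟩, ?_⟩
  · intro i h
    have h := congrArg Fin.val h
    rw [Equiv.ofBijective_apply, hv] at h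
    split_ifs at h <;> omega
  all_goals
    intro i
    rw [Equiv.ofBijective_apply, hv]
    split_ifs <;> omega

theorem final_cyc {n P : ℕ} (hP : P < n) (hP1 : 1 ≤ P) (σ : Equiv.Perm (Fin n))
    (h : PB n P (n-1) σ) : cyc σ = 1 := by
  have hc1 : ∀ m, ∀ hm : m < n, m < P → σ.SameCycle ⟨0, by omega⟩ ⟨m, hm⟩ := by
    intro m
    induction m with
    | zero => intro hm _; exact Equiv.Perm.SameCycle.refl _ _
    | succ m ih =>
      intro hm hmP
      have e : (⟨m+1, hm⟩ : Fin n) = σ ⟨m, by omega⟩ :=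
        Fin.ext (by rw [h.2.2.1 ⟨m, by omega⟩ (by simpa using hmP)])
      rw [e, Equiv.Perm.sameCycle_apply_right]
      exact ih _ (by omega)
  have hc2 : ∀ m, ∀ hm : m < n, P ≤ m → σ.SameCycle ⟨0, by omega⟩ ⟨m, hm⟩ := by
    intro m
    induction m with
    | zero => intro hm _; exact Equiv.Perm.SameCycle.refl _ _
    | succ m ih =>
      intro hm hmP
      rw [← Equiv.Perm.sameCycle_apply_right]
      rcases Nat.lt_or_ge m P with h1 | h1
      · have e : σ ⟨m+1, hm⟩ = ⟨0, by omega⟩ :=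
          Fin.ext (by rw [h.2.1 ⟨m+1, hm⟩ (by simp; omega)])
        rw [e]
      · have e : σ ⟨m+1, hm⟩ = ⟨m, by omega⟩ :=
          Fin.ext (by
            have := h.2.2.2 ⟨m+1, hm⟩ (by simp; omega) (by simp; omega)
            simp at this ⊢; omega)
        rw [e]
        exact ih _ h1
  have hcyc : σ.IsCycle := by
    refine ⟨⟨0, by omega⟩, h.1 _, fun i _ => ?_⟩
    rcases Nat.lt_or_ge i.val P with h1 | h1
    · exact hc1 i.val i.isLt h1
    · exact hc2 i.val i.isLt h1
  unfold cyc
  rw [hcyc.cycleType, Finset.filter_false_of_mem (fun i _ => h.1 i)]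
  simp

theorem final_wt {R : Type*} [CommRing R] {n P : ℕ} (x y : Fin n → R) (hP : P < n) (hP1 : 1 ≤ P)
    (σ : Equiv.Perm (Fin n))
    (h : PB n P (n-1) σ) (hlast : ∀ i : Fin n, i.val + 1 = P → (σ i).val + 1 = n) :
    wt x y σ = -((∏ i ∈ Finset.univ.filter (fun i : Fin n => i.val < P), y i) *
        ∏ i ∈ Finset.univ.filter (fun i : Fin n => P ≤ i.val), x i) := by
  have h1 : rlmIdx σ = Finset.univ.filter (fun i : Fin n => P ≤ i.val) := by
    unfold rlmIdx; ext i
    simp only [mem_filter, mem_univ, true_and]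
    constructor
    · intro h2
      by_contra h3
      exact not_rlm hP σ h.2.1 i (by omega) h2
    · intro h2 l hl
      have hl' : i.val < l.val := hl
      rw [Fin.lt_def]
      have e2 := h.2.2.2 l (by omega) (by omega)
      rcases Nat.eq_or_lt_of_le h2 with h3 | h3
      · have := h.2.1 i h3.symm; omega
      · have := h.2.2.2 i h3 (by omega); omega
  have h2 : excIdx σ = Finset.univ.filter (fun i : Fin n => i.val < P) := by
    unfold excIdx; ext i
    simp only [mem_filter, mem_univ, true_and]
    rw [Fin.lt_def]
    rcases lt_trichotomy i.val P with h5 | h5 | h5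
    · by_cases h6 : i.val + 1 = P
      · have := hlast i h6; omega
      · have := h.2.2.1 i (by omega); omega
    · have := h.2.1 i h5; omega
    · have := h.2.2.2 i h5 (by omega); omega
  unfold wt
  rw [h1, h2, final_cyc hP hP1 σ h]
  ring

/-- With `Fin n` representing `[n]` 0-based (index `i : Fin n` is `i+1`),
`σ ⟨n-j⟩ = ⟨0⟩` encodes `σ(n+1-j) = 1`; `x i` is `x_{i+1}`, `y i` is `y_{i+1}`.
The right side `-y₁⋯y_{n-j} x_{n+1-j}⋯x_n` becomes the product over 0-based
indices `< n-j` for `y` and `≥ n-j` for `x`. -/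
theorem stmt4 {R : Type*} [CommRing R] (n j : ℕ) (x y : Fin n → R)
    (hn : 2 ≤ n) (hj1 : 1 ≤ j) (hj2 : j ≤ n - 1) :
    ∑ σ ∈ Finset.univ.filter (fun σ : Equiv.Perm (Fin n) =>
        (∀ i, σ i ≠ i) ∧ σ ⟨n - j, by omega⟩ = ⟨0, by omega⟩),
      (-1 : R) ^ cyc σ * (∏ i ∈ rlmIdx σ, x i) * (∏ i ∈ excIdx σ, y i)
    = -((∏ i ∈ Finset.univ.filter (fun i : Fin n => i.val < n - j), y i) *
        ∏ i ∈ Finset.univ.filter (fun i : Fin n => n - j ≤ i.val), x i) := by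
  classical
  obtain ⟨P, hPdef⟩ : ∃ P, P = n - j := ⟨_, rfl⟩
  have hP : P < n := by omega
  have hP1 : 1 ≤ P := by omega
  have hA : ∀ k, k < P → ∑ σ ∈ univ.filter (PA n P 0), wt x y σ =
      ∑ σ ∈ univ.filter (PA n P k), wt x y σ := by
    intro k
    induction k with
    | zero => intro _; rfl
    | succ k ih => intro hk; rw [ih (by omega), stepA x y hP hk]
  have hB : ∀ k, P ≤ k → k < n → ∑ σ ∈ univ.filter (PB n P P), wt x y σ =
      ∑ σ ∈ univ.filter (PB n P k), wt x y σ := by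
    intro k hk
    induction k, hk using Nat.le_induction with
    | base => intro _; rfl
    | succ k hk ih => intro hkn; rw [ih (by omega), stepB x y hP hP1 hk hkn]
  have e1 : (Finset.univ.filter (fun σ : Equiv.Perm (Fin n) =>
        (∀ i, σ i ≠ i) ∧ σ ⟨n - j, by omega⟩ = ⟨0, by omega⟩)) = univ.filter (PA n P 0) := by
    ext σ
    simp only [mem_filter, mem_univ, true_and]
    unfold PA
    constructor
    · rintro ⟨h1, h2⟩
      refine ⟨h1, fun i hi => ?_, fun i hi => absurd hi (by omega)⟩
      have : i = ⟨n - j, by omega⟩ := Fin.ext (by simp; omega)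
      rw [this, h2]
    · rintro ⟨h1, h2, _⟩
      exact ⟨h1, Fin.ext (h2 _ hPdef.symm)⟩
  have e2 : univ.filter (PA n P (P-1)) = univ.filter (PB n P P) := by
    ext σ
    simp only [mem_filter, mem_univ, true_and]
    unfold PA PB
    constructor
    · rintro ⟨h1, h2, h3⟩
      exact ⟨h1, h2, fun i hi => h3 i (by omega), fun i hi hi2 => absurd hi (by omega)⟩
    · rintro ⟨h1, h2, h3, _⟩
      exact ⟨h1, h2, fun i hi => h3 i (by omega)⟩
  obtain ⟨ρ, hρ, hρl⟩ := final_exists hP hP1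
  have e3 : univ.filter (PB n P (n-1)) = {ρ} := by
    ext σ
    simp only [mem_filter, mem_univ, true_and, mem_singleton]
    exact ⟨fun h => final_unique hP hP1 σ ρ h hρ, fun h => h ▸ hρ⟩
  have key := final_wt x y hP hP1 ρ hρ hρl
  rw [hPdef] at key
  rw [← key, ← Finset.sum_singleton (wt x y) ρ, ← e3, ← hB (n-1) (by omega) (by omega), ← e2,
    ← hA (P-1) (by omega), ← e1]
  rfl
end

section
/- For n ≥ 2, the sum over all derangements σ of [n] of (-1)^{cyc(σ)} · ∏_{i ∈ RLMv(σ)} x_i · ∏_{i ∈ EXCv(σ)} y_i equals -∑_{j=1}^{n-1} x₁⋯x_j · y_{j+1}⋯y_n. -/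
open Finset

/-- Set of excedance values of a permutation: values v with σ⁻¹ v < v. -/
def excVal {n : ℕ} (σ : Equiv.Perm (Fin n)) : Finset (Fin n) :=
  Finset.univ.filter fun v => σ.symm v < v

/-- Set of right-to-left minimum values. -/
def rlmVal {n : ℕ} (σ : Equiv.Perm (Fin n)) : Finset (Fin n) :=
  (rlmIdx σ).image σ

namespace Drg

variable {R : Type*} [CommRing R] {N : ℕ}

/-- local weight of position `i` -/
def u (x y : ℕ → R) (π : Equiv.Perm (Fin N)) (i : Fin N) : R :=
  (if ∀ j, j < i → π j < π i then x i.val else 1) * (if π i < i then y i.val else 1)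

def w (x y : ℕ → R) (k : ℕ) (π : Equiv.Perm (Fin N)) : R :=
  ∏ i ∈ univ.filter (fun i : Fin N => i.val < k), u x y π i

def P (m k : ℕ) (π : Equiv.Perm (Fin N)) : Prop :=
  (∀ i : Fin N, i.val < k → π i ≠ i) ∧
  (∀ i : Fin N, k ≤ i.val → i.val < m → (π i).val < k) ∧
  (∀ i : Fin N, m ≤ i.val → π i = i)

noncomputable instance (m k : ℕ) (π : Equiv.Perm (Fin N)) : Decidable (P m k π) :=
  Classical.dec _

noncomputable def f (x y : ℕ → R) (m k : ℕ) (π : Equiv.Perm (Fin N)) : R :=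
  if P m k π then ((Equiv.Perm.sign π : ℤ) : R) * w x y k π else 0

noncomputable def S (N : ℕ) (x y : ℕ → R) (m k : ℕ) : R :=
  ∑ π : Equiv.Perm (Fin N), f x y m k π

lemma w_succ (x y : ℕ → R) (p : Fin N) (π : Equiv.Perm (Fin N)) :
    w x y (p.val + 1) π = u x y π p * w x y p.val π := by
  unfold w
  have : univ.filter (fun i : Fin N => i.val < p.val + 1)
      = insert p (univ.filter (fun i : Fin N => i.val < p.val)) := by
    ext i; simp [Fin.ext_iff]; omega
  rw [this, prod_insert (by simp)]

lemma w_congr (x y : ℕ → R) (k : ℕ) (π ρ : Equiv.Perm (Fin N))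
    (h1 : ∀ i j : Fin N, i.val < k → j < i → (π j < π i ↔ ρ j < ρ i))
    (h2 : ∀ i : Fin N, i.val < k → (π i < i ↔ ρ i < i)) :
    w x y k π = w x y k ρ := by
  unfold w
  refine prod_congr rfl fun i hi => ?_
  simp only [mem_filter, mem_univ, true_and] at hi
  unfold u
  have e : (∀ j, j < i → π j < π i) ↔ (∀ j, j < i → ρ j < ρ i) :=
    forall_congr' fun j => forall_congr' fun hj => h1 i j hi hj
  simp only [e, h2 i hi]

lemma w_mul_right (x y : ℕ → R) (k : ℕ) (π : Equiv.Perm (Fin N)) (p q : Fin N)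
    (hp : k ≤ p.val) (hq : k ≤ q.val) :
    w x y k (π * Equiv.swap p q) = w x y k π := by
  have e : ∀ i : Fin N, i.val < k → (π * Equiv.swap p q) i = π i := by
    intro i hi
    rw [Equiv.Perm.mul_apply, Equiv.swap_apply_of_ne_of_ne]
    · rintro rfl; omega
    · rintro rfl; omega
  apply w_congr
  · intro i j hi hj
    rw [e i hi, e j (lt_trans (Fin.lt_def.1 hj) hi)]
  · intro i hi
    rw [e i hi]

lemma S_zero (x y : ℕ → R) (k : ℕ) (p q : Fin N) (hp : p.val = k) (hq : q.val = k + 1) :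
    S N x y (k + 2) k = 0 := by
  have hpq : p ≠ q := by rintro rfl; omega
  unfold S
  refine sum_involution (fun π _ => π * Equiv.swap p q) ?_ ?_ (by simp) ?_
  · intro π _
    have hP : P (k+2) k (π * Equiv.swap p q) ↔ P (k+2) k π := by
      have key : ∀ π : Equiv.Perm (Fin N), P (k+2) k π → P (k+2) k (π * Equiv.swap p q) := by
        rintro π ⟨h1, h2, h3⟩
        refine ⟨fun i hi => ?_, fun i hi hi' => ?_, fun i hi => ?_⟩
        · rw [Equiv.Perm.mul_apply, Equiv.swap_apply_of_ne_of_ne (by rintro rfl; omega) (by rintro rfl; omega)]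
          exact h1 i hi
        · rw [Equiv.Perm.mul_apply]
          have : i = p ∨ i = q := by simp only [Fin.ext_iff]; omega
          rcases this with rfl | rfl
          · rw [Equiv.swap_apply_left]; exact h2 _ (by omega) (by omega)
          · rw [Equiv.swap_apply_right]; exact h2 _ (by omega) (by omega)
        · rw [Equiv.Perm.mul_apply, Equiv.swap_apply_of_ne_of_ne (by rintro rfl; omega) (by rintro rfl; omega)]
          exact h3 i hi
      refine ⟨fun h => ?_, key π⟩
      have := key _ h
      rwa [mul_assoc, Equiv.swap_mul_self, mul_one] at this
    unfold f
    rw [w_mul_right x y k π p q (by omega) (by omega)]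
    simp only [hP, Equiv.Perm.sign_mul, Equiv.Perm.sign_swap hpq]
    split_ifs <;> simp
  · intro π _ _ h
    have := congrArg (fun g : Equiv.Perm (Fin N) => π⁻¹ * g) h
    simp only [inv_mul_cancel_left, inv_mul_cancel] at this
    exact hpq (Equiv.swap_eq_one_iff.1 this)
  · intro π _
    simp [mul_assoc]

/-- not a record if some earlier value is bigger -/
lemma u_low (x y : ℕ → R) (π : Equiv.Perm (Fin N)) (p : Fin N)
    (h : π p < p) : u x y π p = y p.val := by
  unfold u
  rw [if_pos h, if_neg, one_mul]
  intro hj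
  -- all positions ≤ p have values < p
  have hm : ∀ j ∈ Finset.Iic p, π j ∈ Finset.Iio p := by
    intro j hjm
    rw [Finset.mem_Iic] at hjm
    rw [Finset.mem_Iio]
    rcases hjm.eq_or_lt with rfl | hlt
    · exact h
    · exact (hj j hlt).trans h
  have := Finset.card_le_card_of_injOn π hm π.injective.injOn
  simp at this

lemma A_succ (x y : ℕ → R) (p : Fin N) :
    S N x y (p.val+1) (p.val+1) = y p.val * S N x y (p.val+1) p.val := by
  unfold S
  rw [mul_sum]
  refine sum_congr rfl fun π _ => ?_
  have hP : P (p.val+1) (p.val+1) π ↔ P (p.val+1) p.val π := by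
    constructor
    · rintro ⟨h1, h2, h3⟩
      refine ⟨fun i hi => h1 i (by omega), fun i hi hi' => ?_, h3⟩
      have hip : i = p := Fin.ext (by omega)
      subst hip
      have a := h1 i hi'
      by_contra hc
      have hlt : i.val + 1 ≤ (π i).val := by
        have : (π i).val ≠ i.val := fun h => a (Fin.ext h)
        omega
      exact a (π.injective (h3 _ hlt))
    · rintro ⟨h1, h2, h3⟩
      refine ⟨fun i hi => ?_, fun i hi hi' => by omega, h3⟩
      rcases Nat.lt_succ_iff_lt_or_eq.1 hi with h | h
      · exact h1 i h
      · intro hh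
        have := h2 i (by omega) (by omega)
        rw [hh] at this
        omega
  unfold f
  simp only [hP]
  split_ifs with h
  · rw [w_succ, u_low x y π p (Fin.lt_def.2 (h.2.1 p le_rfl (by omega)))]
    ring
  · simp

lemma B_succ_pt (x y : ℕ → R) (p q : Fin N) (hq : q.val = p.val + 1) (π : Equiv.Perm (Fin N)) :
    f x y (p.val+2) (p.val+1) π =
      - x p.val * f x y p.val p.val (π * Equiv.swap p q)
      - x p.val * f x y (p.val+1) p.val (π * Equiv.swap p q)
      - y p.val * f x y (p.val+1) p.val (Equiv.swap p q * π)
      + y p.val * f x y (p.val+2) p.val π := by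
  have hpq : p ≠ q := by rintro rfl; omega
  have hsw : ∀ i, i ≠ p → i ≠ q → Equiv.swap p q i = i := fun i => Equiv.swap_apply_of_ne_of_ne
  have hpv : ∀ i : Fin N, i.val = p.val → i = p := fun i h => Fin.ext h
  have hqv : ∀ i : Fin N, i.val = p.val + 1 → i = q := fun i h => Fin.ext (h.trans hq.symm)
  have hsl : ∀ i : Fin N, i.val < p.val → Equiv.swap p q i = i := fun i h =>
    hsw i (by rintro rfl; omega) (by rintro rfl; omega)
  have hsh : ∀ i : Fin N, p.val + 2 ≤ i.val → Equiv.swap p q i = i := fun i h =>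
    hsw i (by rintro rfl; omega) (by rintro rfl; omega)
  have hs1 : Equiv.swap p q p = q := Equiv.swap_apply_left p q
  have hs2 : Equiv.swap p q q = p := Equiv.swap_apply_right p q
  have e1 : P p.val p.val (π * Equiv.swap p q) ↔
      P (p.val+2) (p.val+1) π ∧ π p = q ∧ π q = p := by
    constructor
    · rintro ⟨h1, h2, h3⟩
      simp only [Equiv.Perm.mul_apply] at h1 h2 h3
      have hp := h3 q (by omega)
      have hq' := h3 p le_rfl
      rw [hs2] at hp
      rw [hs1] at hq'
      refine ⟨⟨fun i hi => ?_, fun i hi hi' => ?_, fun i hi => ?_⟩, hp, hq'⟩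
      · rcases Nat.lt_succ_iff_lt_or_eq.1 hi with h | h
        · have := h1 i h; rwa [hsl i h] at this
        · rw [hpv i h, hp]; exact hpq.symm
      · rw [hqv i (by omega), hq']; omega
      · have := h3 i (by omega); rwa [hsh i hi] at this
    · rintro ⟨⟨h1, h2, h3⟩, hp, hq'⟩
      refine ⟨fun i hi => ?_, fun i hi hi' => by omega, fun i hi => ?_⟩ <;> rw [Equiv.Perm.mul_apply]
      · rw [hsl i hi]; exact h1 i (by omega)
      · rcases (by omega : i.val = p.val ∨ i.val = p.val + 1 ∨ p.val + 2 ≤ i.val) with h | h | h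
        · rw [hpv i h, hs1, hq']
        · rw [hqv i h, hs2, hp]
        · rw [hsh i h]; exact h3 i h
  have e2 : P (p.val+1) p.val (π * Equiv.swap p q) ↔
      P (p.val+2) (p.val+1) π ∧ π p = q ∧ π q < p := by
    constructor
    · rintro ⟨h1, h2, h3⟩
      simp only [Equiv.Perm.mul_apply] at h1 h2 h3
      have hp := h3 q (by omega)
      have hq' := h2 p le_rfl (by omega)
      rw [hs2] at hp
      rw [hs1] at hq'
      refine ⟨⟨fun i hi => ?_, fun i hi hi' => ?_, fun i hi => ?_⟩, hp, Fin.lt_def.2 hq'⟩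
      · rcases Nat.lt_succ_iff_lt_or_eq.1 hi with h | h
        · have := h1 i h; rwa [hsl i h] at this
        · rw [hpv i h, hp]; exact hpq.symm
      · rw [hqv i (by omega)]; omega
      · have := h3 i (by omega); rwa [hsh i hi] at this
    · rintro ⟨⟨h1, h2, h3⟩, hp, hq'⟩
      refine ⟨fun i hi => ?_, fun i hi hi' => ?_, fun i hi => ?_⟩ <;> rw [Equiv.Perm.mul_apply]
      · rw [hsl i hi]; exact h1 i (by omega)
      · rw [hpv i (by omega), hs1]; exact hq'
      · rcases (by omega : i.val = p.val + 1 ∨ p.val + 2 ≤ i.val) with h | h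
        · rw [hqv i h, hs2, hp]
        · rw [hsh i h]; exact h3 i h
  have e3 : P (p.val+1) p.val (Equiv.swap p q * π) ↔
      P (p.val+2) (p.val+1) π ∧ π p < p ∧ π q = p := by
    have hinv : ∀ a b, Equiv.swap p q a = b ↔ a = Equiv.swap p q b := by
      intro a b
      exact Equiv.swap_apply_eq_iff
    have hlow : ∀ a : Fin N, (Equiv.swap p q a).val < p.val ↔ a.val < p.val := by
      intro a
      rcases eq_or_ne a p with rfl | h
      · rw [hs1]; omega
      · rcases eq_or_ne a q with rfl | h'
        · rw [hs2]; omega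
        · rw [hsw a h h']
    constructor
    · rintro ⟨h1, h2, h3⟩
      simp only [Equiv.Perm.mul_apply, hinv, hlow] at h1 h2 h3
      have hp := h2 p le_rfl (by omega)
      have hq' := h3 q (by omega)
      rw [hs2] at hq'
      refine ⟨⟨fun i hi => ?_, fun i hi hi' => ?_, fun i hi => ?_⟩, Fin.lt_def.2 hp, hq'⟩
      · rcases Nat.lt_succ_iff_lt_or_eq.1 hi with h | h
        · have := h1 i h; rwa [ne_eq, hinv, hsl i h] at this
        · rw [hpv i h]; intro h; rw [h] at hp; omega
      · rw [hqv i (by omega), hq']; omega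
      · have := h3 i (by omega); rwa [hsh i hi] at this
    · rintro ⟨⟨h1, h2, h3⟩, hp, hq'⟩
      refine ⟨fun i hi => ?_, fun i hi hi' => ?_, fun i hi => ?_⟩ <;> rw [Equiv.Perm.mul_apply]
      · rw [ne_eq, hinv, hsl i hi]; exact h1 i (by omega)
      · rw [hpv i (by omega), hlow]; exact hp
      · rcases (by omega : i.val = p.val + 1 ∨ p.val + 2 ≤ i.val) with h | h
        · rw [hqv i h, hq', hs1]
        · rw [h3 i h, hsh i h]
  have e4 : P (p.val+2) p.val π ↔
      P (p.val+2) (p.val+1) π ∧ π p < p ∧ π q < p := by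
    constructor
    · rintro ⟨h1, h2, h3⟩
      have hp := h2 p le_rfl (by omega)
      have hq' := h2 q (by omega) (by omega)
      refine ⟨⟨fun i hi => ?_, fun i hi hi' => ?_, h3⟩, Fin.lt_def.2 hp, Fin.lt_def.2 hq'⟩
      · rcases Nat.lt_succ_iff_lt_or_eq.1 hi with h | h
        · exact h1 i h
        · rw [hpv i h]; intro h; rw [h] at hp; omega
      · have := h2 i (by omega) hi'; omega
    · rintro ⟨⟨h1, h2, h3⟩, hp, hq'⟩
      refine ⟨fun i hi => h1 i (by omega), fun i hi hi' => ?_, h3⟩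
      rcases (by omega : i.val = p.val ∨ i.val = p.val + 1) with h | h
      · rw [hpv i h]; exact hp
      · rw [hqv i h]; exact hq'
  have hrec : P (p.val+2) (p.val+1) π → π p = q → u x y π p = x p.val := by
    intro h hp
    unfold u
    rw [if_pos, if_neg, mul_one]
    · rw [hp, Fin.lt_def]; omega
    · intro j hj
      rw [hp]
      by_contra hc
      have h3 := h.2.2 
      rcases eq_or_ne (π j) q with hh | hh
      · rw [← hp] at hh
        exact hj.ne (π.injective hh)
      · have := h3 (π j) (by rw [not_lt, Fin.le_def] at hc; have : (π j).val ≠ q.val := fun h => hh (Fin.ext h)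
                             omega)
        have := π.injective this
        rw [this] at hc
        rw [Fin.lt_def] at hc hj
        omega
  have hw3 : π q = p → w x y p.val (Equiv.swap p q * π) = w x y p.val π := by
    intro hqp
    have hne : ∀ i : Fin N, i.val < p.val → π i ≠ p := by
      intro i hi h
      rw [← hqp] at h
      have := π.injective h
      subst this; omega
    have hv : ∀ i : Fin N, i.val < p.val →
        (π i = q ∧ (Equiv.swap p q * π) i = p) ∨ (π i ≠ q ∧ π i ≠ p ∧ (Equiv.swap p q * π) i = π i) := by
      intro i hi
      rw [Equiv.Perm.mul_apply]
      by_cases h : π i = q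
      · left; rw [h]; simp
      · right; exact ⟨h, hne i hi, hsw _ (hne i hi) h⟩
    apply w_congr
    · intro i j hi hj
      have hj' : j.val < p.val := by rw [Fin.lt_def] at hj; omega
      have hij : π i ≠ π j := fun h => hj.ne (π.injective h).symm
      rcases hv i hi with ⟨a, b⟩ | ⟨a, a', b⟩ <;> rcases hv j hj' with ⟨c, d⟩ | ⟨c, c', d⟩ <;> rw [b, d] <;>
        simp only [Fin.lt_def, Fin.ext_iff, ne_eq] at a c hij ⊢ <;>
        (try simp only [Fin.ext_iff, ne_eq] at a') <;> (try simp only [Fin.ext_iff, ne_eq] at c') <;> omega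
    · intro i hi
      rcases hv i hi with ⟨a, b⟩ | ⟨a, a', b⟩ <;> rw [b]
      rw [a]; simp only [Fin.lt_def]; omega
  have hsplit : P (p.val+2) (p.val+1) π →
      (π p = q ∧ π q = p) ∨ (π p = q ∧ π q < p) ∨ (π p < p ∧ π q = p) ∨ (π p < p ∧ π q < p) := by
    rintro ⟨h1, h2, h3⟩
    have a := h1 p (by omega)
    have b := h2 q (by omega) (by omega)
    have c : (π p).val < p.val + 2 := by
      by_contra hc
      have := π.injective (h3 (π p) (by omega))
      exact a this
    simp only [Fin.lt_def, Fin.ext_iff, ne_eq] at *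
    omega
  have ir : ¬ (q < p) := by rw [Fin.lt_def]; omega
  unfold f
  simp only [e1, e2, e3, e4, w_mul_right x y p.val π p q le_rfl (by omega : p.val ≤ q.val),
    Equiv.Perm.sign_mul, Equiv.Perm.sign_swap hpq]
  by_cases hP : P (p.val+2) (p.val+1) π
  · simp only [hP, true_and, if_true, w_succ]
    rcases hsplit hP with ⟨a, b⟩ | ⟨a, b⟩ | ⟨a, b⟩ | ⟨a, b⟩
    · rw [hrec hP a]
      simp [a, b, hpq, hpq.symm, ir]; ring
    · rw [hrec hP a]
      simp [a, b, b.ne, hpq, hpq.symm, ir]; ring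
    · rw [u_low x y π p a, hw3 b]
      have : π p ≠ q := by rintro h; rw [h] at a; exact ir a
      simp [a, b, this]; ring
    · rw [u_low x y π p a]
      have : π p ≠ q := by rintro h; rw [h] at a; exact ir a
      simp [a, b, b.ne, this]; ring
  · simp [hP]

lemma B_succ (x y : ℕ → R) (p q : Fin N) (hq : q.val = p.val + 1) :
    S N x y (p.val+2) (p.val+1) =
      - x p.val * (S N x y p.val p.val + S N x y (p.val+1) p.val)
      - y p.val * S N x y (p.val+1) p.val := by
  have h0 := S_zero x y p.val p q rfl hq
  have c1 : ∀ g : Equiv.Perm (Fin N) → R, ∑ π, g (π * Equiv.swap p q) = ∑ π, g π :=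
    fun g => Equiv.sum_comp (Equiv.mulRight (Equiv.swap p q)) g
  have c2 : ∀ g : Equiv.Perm (Fin N) → R, ∑ π, g (Equiv.swap p q * π) = ∑ π, g π :=
    fun g => Equiv.sum_comp (Equiv.mulLeft (Equiv.swap p q)) g
  unfold S at *
  simp only [B_succ_pt x y p q hq, sum_add_distrib, sum_sub_distrib, ← mul_sum, h0]
  rw [c1 (f x y p.val p.val), c1 (f x y (p.val+1) p.val), c2 (f x y (p.val+1) p.val)]
  ring

lemma A_zero (x y : ℕ → R) : S N x y 0 0 = 1 := by
  unfold S
  rw [Finset.sum_eq_single 1]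
  · unfold f
    rw [if_pos]
    · simp [w]
    · exact ⟨by simp, by simp, by simp⟩
  · intro π _ h
    unfold f
    rw [if_neg]
    rintro ⟨-, -, h3⟩
    exact h (Equiv.ext fun i => h3 i (by omega))
  · simp

lemma B_zero (x y : ℕ → R) (hN : 0 < N) : S N x y 1 0 = 0 := by
  unfold S
  refine sum_eq_zero fun π _ => ?_
  unfold f
  rw [if_neg]
  rintro ⟨-, h2, -⟩
  exact absurd (h2 ⟨0, hN⟩ le_rfl (by simp)) (by omega)

lemma closed (x y : ℕ → R) (k : ℕ) (hk : k + 1 ≤ N) :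
    S N x y k k + S N x y (k+1) k = (-1)^k * ∏ i ∈ range k, x i ∧
    S N x y (k+1) k = (-1)^k * ∑ j ∈ Icc 1 k, (∏ i ∈ range j, x i) * ∏ i ∈ Ico j k, y i := by
  induction k with
  | zero => simp [A_zero, B_zero x y hk]
  | succ k ih =>
    obtain ⟨h1, h2⟩ := ih (by omega)
    have a := A_succ x y (⟨k, by omega⟩ : Fin N)
    have b := B_succ x y (⟨k, by omega⟩ : Fin N) ⟨k+1, by omega⟩ rfl
    simp only at a b
    constructor
    · rw [a, b, h1, prod_range_succ]; ring
    · rw [b, h1, h2, sum_Icc_succ_top (by omega)]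
      have : ∑ j ∈ Icc 1 k, (∏ i ∈ range j, x i) * ∏ i ∈ Ico j (k+1), y i
        = y k * ∑ j ∈ Icc 1 k, (∏ i ∈ range j, x i) * ∏ i ∈ Ico j k, y i := by
        rw [mul_sum]
        refine sum_congr rfl fun j hj => ?_
        rw [prod_Ico_succ_top (mem_Icc.1 hj).2]; ring
      rw [this, prod_range_succ]
      simp; ring

lemma sign_cyc (σ : Equiv.Perm (Fin N)) (h : ∀ i, σ i ≠ i) :
    (-1 : R) ^ cyc σ = (-1)^N * ((Equiv.Perm.sign σ : ℤ) : R) := by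
  have h0 : (univ.filter fun i => σ i = i) = ∅ := by simp [Finset.filter_eq_empty_iff, h]
  have hs : σ.support = univ := by ext i; simp [h]
  have hN : σ.cycleType.sum = N := by rw [Equiv.Perm.sum_cycleType, hs]; simp
  unfold cyc
  rw [h0, Equiv.Perm.sign_of_cycleType, hN]
  simp only [card_empty, add_zero]
  push_cast
  rw [pow_add, ← mul_assoc, ← pow_add, Even.neg_one_pow ⟨N, rfl⟩, one_mul]

lemma rlm_eq (σ : Equiv.Perm (Fin N)) :
    rlmVal σ = univ.filter (fun v => ∀ j, j < v → σ⁻¹ j < σ⁻¹ v) := by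
  have I1 : ∀ i, σ⁻¹ (σ i) = i := fun i => σ.symm_apply_apply i
  have I2 : ∀ i, σ (σ⁻¹ i) = i := fun i => σ.apply_symm_apply i
  ext v
  simp only [rlmVal, rlmIdx, mem_image, mem_filter, mem_univ, true_and]
  constructor
  · rintro ⟨i, hi, rfl⟩ j hj
    rw [I1]
    by_contra hc
    rcases (not_lt.1 hc).eq_or_lt with h | h
    · rw [h] at hj; simp at hj
    · have := hi _ h
      rw [I2] at this
      exact lt_asymm hj this
  · intro h
    refine ⟨σ⁻¹ v, fun k hk => ?_, by simp⟩
    rw [I2]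
    by_contra hc
    rcases (not_lt.1 hc).eq_or_lt with h' | h'
    · rw [← h'] at hk; simp at hk
    · have := h _ h'
      rw [I1] at this
      exact lt_asymm hk this

lemma main_eq (x y : ℕ → R) :
    ∑ σ ∈ Finset.univ.filter (fun σ : Equiv.Perm (Fin N) => ∀ i, σ i ≠ i),
      (-1 : R) ^ cyc σ * (∏ i ∈ rlmVal σ, x i) * (∏ i ∈ excVal σ, y i)
    = (-1)^N * S N x y N N := by
  unfold S
  rw [← Equiv.sum_comp (Equiv.inv (Equiv.Perm (Fin N))), mul_sum, sum_filter]
  refine sum_congr rfl fun σ _ => ?_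
  have hP : P N N σ⁻¹ ↔ ∀ i, σ i ≠ i := by
    constructor
    · rintro ⟨h, -, -⟩ i hi
      exact h i i.2 (by rw [Equiv.Perm.inv_eq_iff_eq, hi])
    · intro h
      refine ⟨fun i _ hi => ?_, fun i hi => absurd i.2 (by omega), fun i hi => absurd i.2 (by omega)⟩
      rw [Equiv.Perm.inv_eq_iff_eq] at hi
      exact h i hi.symm
  simp only [Equiv.inv_apply, f, hP]
  split_ifs with h
  · rw [sign_cyc σ h, rlm_eq, Equiv.Perm.sign_inv]
    have : w x y N σ⁻¹ = (∏ i ∈ univ.filter (fun v => ∀ j, j < v → σ⁻¹ j < σ⁻¹ v), x i.val) *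
        ∏ i ∈ excVal σ, y i.val := by
      unfold w u excVal
      rw [prod_mul_distrib, prod_filter, prod_filter, prod_filter, prod_filter]
      simp only [Fin.is_lt, if_true]
      rfl
    rw [this]; ring
  · simp

end Drg

theorem stmt5 {R : Type*} [CommRing R] (n : ℕ) (x y : Fin n → R) (hn : 2 ≤ n) :
    ∑ σ ∈ Finset.univ.filter (fun σ : Equiv.Perm (Fin n) => ∀ i, σ i ≠ i),
      (-1 : R) ^ cyc σ * (∏ i ∈ rlmVal σ, x i) * (∏ i ∈ excVal σ, y i)
    = -∑ j ∈ Finset.Icc 1 (n - 1),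
        (∏ i ∈ Finset.univ.filter (fun i : Fin n => i.val < j), x i) *
          ∏ i ∈ Finset.univ.filter (fun i : Fin n => j ≤ i.val), y i := by
  obtain ⟨m, rfl⟩ : ∃ m, n = m + 1 := ⟨n - 1, by omega⟩
  obtain ⟨X, rfl⟩ : ∃ X : ℕ → R, x = fun i => X i.val :=
    ⟨fun i => if h : i < m + 1 then x ⟨i, h⟩ else 0, by ext i; simp only [dif_pos i.2]⟩
  obtain ⟨Y, rfl⟩ : ∃ Y : ℕ → R, y = fun i => Y i.val :=
    ⟨fun i => if h : i < m + 1 then y ⟨i, h⟩ else 0, by ext i; simp only [dif_pos i.2]⟩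
  have h1 := Drg.main_eq (N := m + 1) X Y
  have h2 := Drg.A_succ (N := m + 1) X Y ⟨m, by omega⟩
  have h3 := (Drg.closed (N := m + 1) X Y m le_rfl).2
  simp only at h2
  rw [h1, h2, h3]
  have hx : ∀ j, j ≤ m → ∏ i ∈ Finset.univ.filter (fun i : Fin (m+1) => i.val < j), X i.val
      = ∏ i ∈ range j, X i := by
    intro j hj
    rw [prod_filter, Fin.prod_univ_eq_prod_range (fun i => if i < j then X i else 1), ← prod_filter]
    congr 1
    ext i; simp; omega
  have hy : ∀ j, ∏ i ∈ Finset.univ.filter (fun i : Fin (m+1) => j ≤ i.val), Y i.val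
      = ∏ i ∈ Ico j (m+1), Y i := by
    intro j
    rw [prod_filter, Fin.prod_univ_eq_prod_range (fun i => if j ≤ i then Y i else 1), ← prod_filter]
    congr 1
    ext i; simp; omega
  have hs : ∑ j ∈ Finset.Icc 1 (m + 1 - 1),
        (∏ i ∈ Finset.univ.filter (fun i : Fin (m+1) => i.val < j), X i.val) *
          ∏ i ∈ Finset.univ.filter (fun i : Fin (m+1) => j ≤ i.val), Y i.val
      = Y m * ∑ j ∈ Icc 1 m, (∏ i ∈ range j, X i) * ∏ i ∈ Ico j m, Y i := by
    rw [mul_sum]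
    refine sum_congr (by simp) fun j hj => ?_
    rw [mem_Icc] at hj
    rw [hx j (by omega), hy j, prod_Ico_succ_top hj.2]; ring
  rw [hs]
  have e : (-1 : R)^m * (-1)^m = 1 := by rw [← pow_add, Even.neg_one_pow ⟨m, rfl⟩]
  rw [pow_succ]
  linear_combination (-(Y m * ∑ j ∈ Icc 1 m, (∏ i ∈ range j, X i) * ∏ i ∈ Ico j m, Y i)) * e
end

section
/- For n ≥ 2, the sum over all derangements σ of [n] of (-1)^{cyc(σ)} · ∏_{i ∈ RLMi(σ)} x_i · ∏_{i ∈ EXCi(σ)} y_i equals -∑_{j=1}^{n-1} y₁⋯y_j · x_{j+1}⋯x_n. -/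
open Finset

/-- Right-to-left minimum factor. -/
def rF {R : Type*} [CommRing R] {n : ℕ} (x : Fin n → R) (σ : Equiv.Perm (Fin n)) (i : Fin n) : R :=
  if ∀ k, i < k → σ i < σ k then x i else 1

/-- Derangement and excedance factor. -/
def aF {R : Type*} [CommRing R] {n : ℕ} (y : Fin n → R) (i j : Fin n) : R :=
  if j = i then 0 else if i < j then y i else 1

/-- Sign in the ring. -/
def sF (R : Type*) [CommRing R] {n : ℕ} (σ : Equiv.Perm (Fin n)) : R :=
  ((Equiv.Perm.sign σ : ℤ) : R)

/-- Weight of a permutation. -/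
def wF {R : Type*} [CommRing R] {n : ℕ} (x y : Fin n → R) (σ : Equiv.Perm (Fin n)) : R :=
  ∏ i, (rF x σ i * aF y i (σ i))

/-- Weight without the first position. -/
def gF {R : Type*} [CommRing R] {n : ℕ} (x y : Fin (n+1) → R) (σ : Equiv.Perm (Fin (n+1))) : R :=
  ∏ i : Fin n, (rF x σ i.succ * aF y i.succ (σ i.succ))

/-- Weight with a marked position. -/
def hF {R : Type*} [CommRing R] {n : ℕ} (x y : Fin n → R) (σ : Equiv.Perm (Fin n)) (i : Fin n) : R :=
  ∏ k, (if k = i then x i else (if i < k then rF x σ k else 1) * aF y k (σ k))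

/-- Signed sum over derangements. -/
def dF {R : Type*} [CommRing R] {n : ℕ} (x y : Fin n → R) : R := ∑ σ, sF R σ * wF x y σ

/-- Signed sum with first position free. -/
def fF {R : Type*} [CommRing R] {n : ℕ} (x y : Fin (n+1) → R) : R := ∑ σ, sF R σ * gF x y σ

theorem neg_one_pow_cyc {R : Type*} [CommRing R] {n : ℕ} (σ : Equiv.Perm (Fin n)) :
    (-1 : R) ^ cyc σ = (-1) ^ n * sF R σ := by
  have h1 : σ.support.card + (Finset.univ.filter fun i => σ i = i).card = n := by
    have := Finset.card_filter_add_card_filter_not (s := (univ : Finset (Fin n))) (fun i => σ i = i)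
    simp only [card_univ, Fintype.card_fin] at this
    have h2 : σ.support = univ.filter (fun i => ¬ σ i = i) := by ext; simp
    rw [h2]; omega
  unfold sF cyc
  rw [Equiv.Perm.sign_of_cycleType, Equiv.Perm.sum_cycleType]
  push_cast
  rw [← pow_add]
  apply neg_one_pow_congr
  rw [Nat.even_iff, Nat.even_iff]
  omega

theorem wF_derange {R : Type*} [CommRing R] {n : ℕ} (x y : Fin n → R) (σ : Equiv.Perm (Fin n)) :
    wF x y σ = if (∀ i, σ i ≠ i) then (∏ i ∈ rlmIdx σ, x i) * (∏ i ∈ excIdx σ, y i) else 0 := by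
  unfold wF
  split_ifs with h
  · rw [prod_mul_distrib]
    congr 1
    · rw [rlmIdx, prod_filter]; rfl
    · rw [excIdx, prod_filter]
      exact prod_congr rfl fun i _ => by simp [aF, h i]
  · push Not at h
    obtain ⟨i, hi⟩ := h
    exact prod_eq_zero (mem_univ i) (by simp [aF, hi])

theorem wF_zero {R : Type*} [CommRing R] {n : ℕ} (x y : Fin (n+1) → R)
    (σ : Equiv.Perm (Fin (n+1))) (h : σ 0 = 0) : wF x y σ = 0 :=
  prod_eq_zero (mem_univ 0) (by simp [aF, h])

theorem wF_ne {R : Type*} [CommRing R] {n : ℕ} (x y : Fin (n+1) → R)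
    (σ : Equiv.Perm (Fin (n+1))) (h : σ 0 ≠ 0) : wF x y σ = y 0 * gF x y σ := by
  unfold wF gF
  rw [Fin.prod_univ_succ]
  congr 1
  have h1 : rF x σ 0 = 1 := by
    unfold rF
    rw [if_neg]
    intro hk
    have hne : σ.symm 0 ≠ 0 := by
      intro h2; apply h; exact ((Equiv.symm_apply_eq σ).mp h2).symm
    have := hk (σ.symm 0) (Fin.pos_of_ne_zero hne)
    simp at this
  rw [h1]
  simp [aF, h, Fin.pos_of_ne_zero h]

theorem gF_zero {R : Type*} [CommRing R] {n : ℕ} (x y : Fin (n+1) → R) (e : Equiv.Perm (Fin n)) :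
    gF x y (Equiv.Perm.decomposeFin.symm (0, e)) =
      wF (fun i => x i.succ) (fun i => y i.succ) e := by
  unfold gF wF
  refine prod_congr rfl fun i _ => ?_
  simp [rF, aF, Fin.forall_fin_succ]

theorem gF_succ {R : Type*} [CommRing R] {n : ℕ} (x y : Fin (n+1) → R) (e : Equiv.Perm (Fin n))
    (i : Fin n) :
    gF x y (Equiv.Perm.decomposeFin.symm ((e i).succ, e)) =
      hF (fun i => x i.succ) (fun i => y i.succ) e i := by
  have hv : ∀ k : Fin n, Equiv.Perm.decomposeFin.symm ((e i).succ, e) k.succ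
      = if k = i then 0 else (e k).succ := by
    intro k
    rw [Equiv.Perm.decomposeFin_symm_apply_succ]
    split_ifs with h
    · subst h; simp
    · apply Equiv.swap_apply_of_ne_of_ne
      · exact Fin.succ_ne_zero _
      · simpa using h
  unfold gF hF
  refine prod_congr rfl fun k _ => ?_
  unfold rF aF
  simp only [Fin.forall_fin_succ, hv]
  by_cases hk : k = i
  · subst hk
    simp only [if_true]
    rw [if_pos, if_neg, if_neg]
    · simp
    · simp
    · exact (Fin.succ_ne_zero _).symm
    · refine ⟨by simp, fun l hl => ?_⟩
      rw [if_neg]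
      · simp
      · rintro rfl; simp at hl
  · simp only [if_neg hk]
    congr 1
    · by_cases hik : i < k
      · rw [if_pos hik]
        congr 1
        simp only [Fin.succ_lt_succ_iff, Fin.not_lt_zero, IsEmpty.forall_iff, true_and, eq_iff_iff]
        refine forall_congr' fun l => forall_congr' fun hl => ?_
        rw [if_neg (by rintro rfl; exact absurd hl (not_lt.mpr hik.le)), Fin.succ_lt_succ_iff]
      · rw [if_neg hik, if_neg]
        rintro ⟨-, h⟩
        have := h i (Fin.succ_lt_succ_iff.mpr (lt_of_le_of_ne (not_lt.mp hik) hk))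
        simp at this
    · simp

theorem sF_zero {R : Type*} [CommRing R] {n : ℕ} (e : Equiv.Perm (Fin n)) :
    sF R (Equiv.Perm.decomposeFin.symm (0, e)) = sF R e := by
  simp [sF]

theorem sF_succ {R : Type*} [CommRing R] {n : ℕ} (e : Equiv.Perm (Fin n)) (a : Fin n) :
    sF R (Equiv.Perm.decomposeFin.symm (a.succ, e)) = - sF R e := by
  simp [sF]

theorem sum_decomp {R : Type*} [CommRing R] {n : ℕ} (F : Equiv.Perm (Fin (n+1)) → R) :
    ∑ σ, F σ = ∑ e, F (Equiv.Perm.decomposeFin.symm (0, e)) +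
      ∑ e : Equiv.Perm (Fin n), ∑ i, F (Equiv.Perm.decomposeFin.symm ((e i).succ, e)) := by
  rw [← Equiv.sum_comp Equiv.Perm.decomposeFin.symm, Fintype.sum_prod_type, Fin.sum_univ_succ]
  congr 1
  rw [sum_comm]
  refine sum_congr rfl fun e _ => ?_
  exact (Equiv.sum_comp e (fun a => F (Equiv.Perm.decomposeFin.symm (a.succ, e)))).symm

/-- The auxiliary sum. -/
def pF {R : Type*} [CommRing R] {n : ℕ} (x y : Fin n → R) : R :=
  ∑ e : Equiv.Perm (Fin n), ∑ i, sF R e * hF x y e i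

theorem fF_rec {R : Type*} [CommRing R] {n : ℕ} (x y : Fin (n+1) → R) :
    fF x y = dF (fun i => x i.succ) (fun i => y i.succ)
      - pF (fun i => x i.succ) (fun i => y i.succ) := by
  unfold fF dF pF
  rw [sum_decomp]
  simp only [sF_zero, gF_zero, sF_succ, gF_succ, neg_mul, sum_neg_distrib]
  ring

theorem dF_rec {R : Type*} [CommRing R] {n : ℕ} (x y : Fin (n+1) → R) :
    dF x y = - (y 0 * pF (fun i => x i.succ) (fun i => y i.succ)) := by
  unfold dF pF
  rw [sum_decomp]
  rw [sum_eq_zero (fun e _ => by rw [wF_zero _ _ _ (by simp), mul_zero]), zero_add,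
    mul_sum, ← sum_neg_distrib]
  refine sum_congr rfl fun e _ => ?_
  rw [mul_sum, ← sum_neg_distrib]
  refine sum_congr rfl fun i _ => ?_
  rw [wF_ne _ _ _ (by simp), gF_succ, sF_succ]
  ring

theorem hF_zero {R : Type*} [CommRing R] {n : ℕ} (x y : Fin (n+1) → R)
    (e : Equiv.Perm (Fin (n+1))) : hF x y e 0 = x 0 * gF x y e := by
  unfold hF gF
  rw [Fin.prod_univ_succ]
  simp

theorem hF_eq_wF {R : Type*} [CommRing R] {n : ℕ} (x y : Fin (n+1) → R)
    (e : Equiv.Perm (Fin (n+1))) (i : Fin (n+1)) (hi : i ≠ 0) (h : e i = 0) :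
    hF x y e i = wF x y e := by
  unfold hF wF
  refine prod_congr rfl fun k _ => ?_
  have hpos : ∀ l, l ≠ i → 0 < e l := fun l hl => by
    apply Fin.pos_of_ne_zero
    rw [← h]
    exact fun h2 => hl (e.injective h2)
  split_ifs with h1 h2
  · subst h1
    have hr : rF x e k = x k := by
      unfold rF
      rw [if_pos]
      intro l hl
      rw [h]
      exact hpos l hl.ne'
    rw [hr]
    simp [aF, h, hi.symm]
  · rfl
  · congr 1
    unfold rF
    rw [if_neg]
    intro h3
    have := h3 i (lt_of_le_of_ne (not_lt.mp h2) h1)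
    rw [h] at this
    simp at this

theorem hF_swap {R : Type*} [CommRing R] {n : ℕ} (x y : Fin (n+1) → R)
    (e : Equiv.Perm (Fin (n+1))) (i : Fin (n+1)) (hi : i ≠ 0) (h : e i ≠ 0) (h0 : e 0 ≠ 0) :
    hF x y (e * Equiv.swap 0 i) i = hF x y e i := by
  unfold hF
  refine prod_congr rfl fun k _ => ?_
  split_ifs with h1 h2
  · rfl
  · have hv : ∀ l, i < l → (e * Equiv.swap 0 i) l = e l := fun l hl => by
      rw [Equiv.Perm.mul_apply, Equiv.swap_apply_of_ne_of_ne]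
      · rintro rfl; simp at hl
      · exact hl.ne'
    rw [hv k h2]
    congr 1
    unfold rF
    congr 1
    rw [hv k h2, eq_iff_iff]
    refine forall_congr' fun l => forall_congr' fun hl => ?_
    rw [hv l (h2.trans hl)]
  · congr 1
    by_cases hk : k = 0
    · subst hk
      simp [aF, h, h0, Fin.pos_of_ne_zero h, Fin.pos_of_ne_zero h0]
    · rw [Equiv.Perm.mul_apply, Equiv.swap_apply_of_ne_of_ne hk h1]

theorem sF_swap {R : Type*} [CommRing R] {n : ℕ}
    (e : Equiv.Perm (Fin (n+1))) (i : Fin (n+1)) (hi : i ≠ 0) :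
    sF R (e * Equiv.swap 0 i) = - sF R e := by
  simp [sF, Equiv.Perm.sign_swap hi.symm]

theorem hF_sum {R : Type*} [CommRing R] {n : ℕ} (x y : Fin (n+1) → R)
    (i : Fin (n+1)) (hi : i ≠ 0) :
    ∑ e, sF R e * hF x y e i = ∑ e, if e i = 0 then sF R e * wF x y e else 0 := by
  rw [← sub_eq_zero, ← sum_sub_distrib]
  have key : ∀ e : Equiv.Perm (Fin (n+1)),
      sF R e * hF x y e i - (if e i = 0 then sF R e * wF x y e else 0) =
      if e i ≠ 0 ∧ e 0 ≠ 0 then sF R e * hF x y e i else 0 := by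
    intro e
    by_cases h : e i = 0
    · simp [h, hF_eq_wF x y e i hi h]
    · by_cases h0 : e 0 = 0
      · have : hF x y e i = 0 :=
          prod_eq_zero (mem_univ 0) (by simp [aF, h0, hi.symm])
        simp [h, h0, this]
      · simp [h, h0]
  simp only [key]
  rw [← sum_filter]
  refine sum_involution (fun e _ => e * Equiv.swap 0 i) ?_ ?_ ?_ ?_
  · intro e he
    simp only [mem_filter, mem_univ, true_and] at he
    rw [hF_swap x y e i hi he.1 he.2, sF_swap e i hi]
    ring
  · intro e he _ h
    rw [mul_eq_left, Equiv.swap_eq_one_iff] at h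
    exact hi h.symm
  · intro e he
    simp only [mem_filter, mem_univ, true_and] at he
    simp [he]
  · intro e he
    simp [mul_assoc]

theorem pF_rec {R : Type*} [CommRing R] {n : ℕ} (x y : Fin (n+1) → R) :
    pF x y = x 0 * fF x y + dF x y := by
  unfold pF
  rw [sum_comm, Fin.sum_univ_succ]
  congr 1
  · simp only [hF_zero, fF, mul_sum]
    exact sum_congr rfl fun e _ => by ring
  · simp only [hF_sum x y _ (Fin.succ_ne_zero _)]
    rw [sum_comm]
    unfold dF
    refine sum_congr rfl fun e _ => ?_
    have : sF R e * wF x y e = ∑ i, if e i = 0 then sF R e * wF x y e else 0 := by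
      rw [sum_eq_single (e.symm 0)]
      · simp
      · intro b _ hb
        rw [if_neg]
        rintro h
        exact hb (by rw [← h]; simp)
      · simp
    conv_rhs => rw [this, Fin.sum_univ_succ]
    by_cases h : e 0 = 0
    · simp [wF_zero x y e h]
    · simp [h]

theorem fF_eq {R : Type*} [CommRing R] (n : ℕ) : ∀ (x y : Fin (n+1) → R),
    fF x y = (-1) ^ n * ∏ i : Fin n, x i.succ := by
  induction n with
  | zero => intro x y; simp [fF, gF, sF]
  | succ n ih =>
    intro x y
    rw [fF_rec, pF_rec, ih, Fin.prod_univ_succ]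
    ring

/-- Right-hand side. -/
def tF {R : Type*} [CommRing R] (n : ℕ) (x y : Fin n → R) : R :=
  ∑ j ∈ Finset.Icc 1 (n - 1),
        (∏ i ∈ Finset.univ.filter (fun i : Fin n => i.val < j), y i) *
          ∏ i ∈ Finset.univ.filter (fun i : Fin n => j ≤ i.val), x i

theorem tF_rec {R : Type*} [CommRing R] (n : ℕ) (x y : Fin (n+2) → R) :
    tF (n+2) x y = y 0 * (∏ i : Fin (n+1), x i.succ +
      tF (n+1) (fun i => x i.succ) (fun i => y i.succ)) := by
  unfold tF
  simp only [prod_filter]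
  have e1 : Finset.Icc 1 (n + 2 - 1) = (Finset.range (n+1)).map ⟨(· + 1), add_left_injective 1⟩ := by
    ext a; simp only [mem_Icc, mem_map, mem_range, Function.Embedding.coeFn_mk]
    exact ⟨fun h => ⟨a - 1, by omega, by omega⟩, by rintro ⟨b, h, rfl⟩; omega⟩
  have e2 : Finset.Icc 1 (n + 1 - 1) = (Finset.range n).map ⟨(· + 1), add_left_injective 1⟩ := by
    ext a; simp only [mem_Icc, mem_map, mem_range, Function.Embedding.coeFn_mk]
    exact ⟨fun h => ⟨a - 1, by omega, by omega⟩, by rintro ⟨b, h, rfl⟩; omega⟩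
  rw [e1, e2, sum_map, sum_map, sum_range_succ']
  simp only [Function.Embedding.coeFn_mk]
  rw [add_comm, mul_add, mul_sum]
  congr 1
  · rw [Fin.prod_univ_succ, Fin.prod_univ_succ (n := n+1)]
    simp
  · refine sum_congr rfl fun j _ => ?_
    rw [Fin.prod_univ_succ, Fin.prod_univ_succ (n := n+1)]
    simp [mul_assoc]

theorem dF_eq {R : Type*} [CommRing R] (n : ℕ) : ∀ (x y : Fin (n+1) → R),
    dF x y = (-1) ^ n * tF (n+1) x y := by
  induction n with
  | zero => intro x y; simp [dF, wF, sF, tF, aF]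
  | succ n ih =>
    intro x y
    rw [dF_rec, pF_rec, ih, fF_eq, tF_rec, Fin.prod_univ_succ]
    ring

theorem stmt6 {R : Type*} [CommRing R] (n : ℕ) (x y : Fin n → R) (hn : 2 ≤ n) :
    ∑ σ ∈ Finset.univ.filter (fun σ : Equiv.Perm (Fin n) => ∀ i, σ i ≠ i),
      (-1 : R) ^ cyc σ * (∏ i ∈ rlmIdx σ, x i) * (∏ i ∈ excIdx σ, y i)
    = -∑ j ∈ Finset.Icc 1 (n - 1),
        (∏ i ∈ Finset.univ.filter (fun i : Fin n => i.val < j), y i) *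
          ∏ i ∈ Finset.univ.filter (fun i : Fin n => j ≤ i.val), x i := by
  obtain ⟨m, rfl⟩ : ∃ m, n = m + 1 := ⟨n - 1, by omega⟩
  have h := dF_eq m x y
  change _ = - tF (m+1) x y
  have h2 : ((-1 : R)) ^ (m+1) * dF x y = - tF (m+1) x y := by
    have h3 : ((-1 : R)) ^ m * (-1) ^ m = 1 := by rw [← mul_pow]; simp
    rw [h, pow_succ]
    linear_combination (-tF (m+1) x y) * h3
  rw [← h2, dF, mul_sum, sum_filter]
  refine sum_congr rfl fun σ _ => ?_
  rw [wF_derange, neg_one_pow_cyc]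
  split_ifs
  · ring
  · simp
end
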